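/- For every finite connected simple graph G and every positive integer k, L_{k}(G) ≥ ⌈(1 + diam(G))/3⌉ · k, where diam(G) is the diameter of G. -/

import Mathlib

open Finset SimpleGraph
open scoped Classical

/-- `f` is a `{k}`-packing function of `G`: the sum of `f` over every closed
neighborhood `N[v] = N(v) ∪ {v}` is at most `k`. -/
def IsKPackingFunction {V : Type*} [Fintype V] (G : SimpleGraph V) (k : ℕ) (f : V → ℕ) : Prop :=
  ∀ v : V, ∑ u ∈ insert v (G.neighborFinset v), f u ≤ k

/-- `L_{k}(G)`: the maximum of `∑ v, f v` over all `{k}`-packing functions `f` of `G`. -/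
noncomputable def packingFunctionNumber {V : Type*} [Fintype V] (G : SimpleGraph V) (k : ℕ) : ℕ :=
  sSup {s : ℕ | ∃ f : V → ℕ, IsKPackingFunction G k f ∧ s = ∑ v, f v}

/-- `Z*_rlx(G)`: the optimum of the LP relaxation of the `{1}`-packing problem. -/
noncomputable def Zrlx {V : Type*} [Fintype V] (G : SimpleGraph V) : ℝ :=
  sSup {s : ℝ | ∃ f : V → ℝ, (∀ v, 0 ≤ f v) ∧
    (∀ v : V, ∑ u ∈ insert v (G.neighborFinset v), f u ≤ 1) ∧ s = ∑ v, f v}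

/-- A geodesic contains a vertex at every intermediate distance from its start. -/
lemma SimpleGraph.Connected.exists_dist_eq_of_le {V : Type*} {G : SimpleGraph V}
    (hc : G.Connected) {u w : V} {i : ℕ} (hi : i ≤ G.dist u w) : ∃ x, G.dist u x = i := by
  obtain ⟨p, hp⟩ := hc.exists_walk_length_eq_dist u w
  have h₁ := dist_le (p.take i)
  have h₂ := dist_le (p.drop i)
  have h₃ := hc.dist_triangle (u := u) (v := p.getVert i) (w := w)
  rw [Walk.take_length] at h₁
  rw [Walk.drop_length] at h₂
  exact ⟨p.getVert i, by omega⟩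

lemma IsKPackingFunction.sum_le_packingFunctionNumber {V : Type*} [Fintype V]
    {G : SimpleGraph V} {k : ℕ} {f : V → ℕ} (hf : IsKPackingFunction G k f) :
    ∑ v, f v ≤ packingFunctionNumber G k := by
  refine le_csSup ⟨∑ _v : V, k, ?_⟩ ⟨f, hf, rfl⟩
  rintro s ⟨g, hg, rfl⟩
  exact Finset.sum_le_sum fun v _ ↦
    (Finset.single_le_sum (fun _ _ ↦ Nat.zero_le _) (mem_insert_self v _)).trans (hg v)

/-- If every closed neighborhood meets `S` at most once, then `k` times the indicator function of
`S` is a `{k}`-packing function. -/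
lemma isKPackingFunction_indicator {V : Type*} [Fintype V] {G : SimpleGraph V} {S : Finset V}
    (k : ℕ) (hS : ∀ v, #(insert v (G.neighborFinset v) ∩ S) ≤ 1) :
    IsKPackingFunction G k fun v ↦ if v ∈ S then k else 0 := by
  intro v
  rw [Finset.sum_ite_mem, Finset.sum_const, smul_eq_mul]
  simpa using Nat.mul_le_mul_right k (hS v)

/-- `L_{k}(G) ≥ ⌈(1 + diam(G))/3⌉ · k` for connected `G`. -/
theorem ceil_diam_mul_le_packingFunctionNumber {V : Type*} [Fintype V]
    (G : SimpleGraph V) (hc : G.Connected) (k : ℕ) (hk : 0 < k) :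
    ⌈(1 + (G.diam : ℚ)) / 3⌉ * (k : ℤ) ≤ (packingFunctionNumber G k : ℤ) := by
  have := hc.nonempty
  obtain ⟨u, w, hd⟩ := G.exists_dist_eq_diam
  have hx : ∀ i : ℕ, ∃ x, i ≤ G.diam / 3 → G.dist u x = 3 * i := by
    intro i
    by_cases hi : i ≤ G.diam / 3
    · obtain ⟨x, hx⟩ := hc.exists_dist_eq_of_le (u := u) (w := w) (i := 3 * i) (by omega)
      exact ⟨x, fun _ ↦ hx⟩
    · exact ⟨u, fun h ↦ absurd h hi⟩
  choose x hx using hx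
  set S : Finset V := (Finset.range (G.diam / 3 + 1)).image x with hS
  have hcard : #S = G.diam / 3 + 1 := by
    rw [hS, Finset.card_image_of_injOn, Finset.card_range]
    intro i hi j hj hij
    simp only [coe_range, Set.mem_Iio] at hi hj
    have h₁ := hx i (by omega)
    have h₂ := hx j (by omega)
    rw [hij] at h₁
    omega
  have hpack : ∀ v, #(insert v (G.neighborFinset v) ∩ S) ≤ 1 := by
    intro v
    have hnear : ∀ a ∈ insert v (G.neighborFinset v), G.dist v a ≤ 1 := by
      intro a ha
      rcases mem_insert.1 ha with rfl | ha
      · simp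
      · exact (dist_eq_one_iff_adj.2 ((G.mem_neighborFinset v a).1 ha)).le
    refine Finset.card_le_one.2 fun a ha b hb ↦ ?_
    obtain ⟨hva, ha⟩ := mem_inter.1 ha
    obtain ⟨hvb, hb⟩ := mem_inter.1 hb
    obtain ⟨i, hi, rfl⟩ := Finset.mem_image.1 ha
    obtain ⟨j, hj, rfl⟩ := Finset.mem_image.1 hb
    rw [Finset.mem_range] at hi hj
    have hi' := hx i (by omega)
    have hj' := hx j (by omega)
    have h₁ := hnear _ hva
    have h₂ := hnear _ hvb
    have h₃ := hc.dist_triangle (u := u) (v := v) (w := x i)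
    have h₄ := hc.dist_triangle (u := u) (v := v) (w := x j)
    have h₅ := hc.dist_triangle (u := u) (v := x i) (w := v)
    have h₆ := hc.dist_triangle (u := u) (v := x j) (w := v)
    rw [G.dist_comm (u := x i) (v := v)] at h₅
    rw [G.dist_comm (u := x j) (v := v)] at h₆
    rw [show i = j by omega]
  have hsum := (isKPackingFunction_indicator k hpack).sum_le_packingFunctionNumber
  rw [Finset.sum_ite_mem, Finset.univ_inter, Finset.sum_const, hcard, smul_eq_mul] at hsum
  have hceil : ⌈(1 + (G.diam : ℚ)) / 3⌉ ≤ ((G.diam / 3 + 1 : ℕ) : ℤ) := by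
    rw [Int.ceil_le, div_le_iff₀ (by norm_num)]
    have h : 1 + G.diam ≤ (G.diam / 3 + 1) * 3 := by omega
    exact_mod_cast h
  calc _ ≤ ((G.diam / 3 + 1 : ℕ) : ℤ) * (k : ℤ) := by gcongr
    _ ≤ _ := by exact_mod_cast hsum
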